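/- arXiv:2410.01410 — 3 statements merged into one kernel-verified Lean document; each statement's English description precedes it below -/
import Mathlib

section
/- Suppose every approximate proximal point used by inexact FedExProx is an ε₂-relative approximation, i.e., ‖x̃_{i,k+1} − prox_{γf_i}(x_k)‖² ≤ ε₂ · ‖x_k − prox_{γf_i}(x_k)‖² for all i and k, where 0 ≤ ε₂ < μ²/(4L_max²). Then for any constant extrapolation parameter α with 0 < α ≤ (1/(γL_γ)) · (μ − 2√ε₂ L_max)/(μ + 4√ε₂ L_max + 4ε₂ L_max), the iterates satisfy E_K ≤ (1 − α · γ(μ − 2√ε₂ L_max)/(4(1 + γL_max)))^K · E_0 for every K ≥ 0. -/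
section Gradient

variable {V : Type*} [NormedAddCommGroup V] [InnerProductSpace ℝ V] [CompleteSpace V]

theorem HasGradientAt.hasDerivAt_comp_line {f : V → ℝ} {g x v : V} {t : ℝ}
    (h : HasGradientAt f g (x + t • v)) :
    HasDerivAt (fun s : ℝ => f (x + s • v)) (inner ℝ g v) t := by
  have hl : HasDerivAt (fun s : ℝ => x + s • v) v t := by
    simpa using ((hasDerivAt_id t).smul_const v).const_add x
  exact h.hasFDerivAt.comp_hasDerivAt t hl

/-- The descent lemma for a function with Lipschitz gradient. -/
theorem le_add_inner_add_sq_of_lipschitz_gradient {f : V → ℝ} {f' : V → V} {L : ℝ}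
    (hf : ∀ x, HasGradientAt f (f' x) x) (hL : ∀ x y, ‖f' x - f' y‖ ≤ L * ‖x - y‖) (x y : V) :
    f y ≤ f x + inner ℝ (f' x) (y - x) + L / 2 * ‖y - x‖ ^ 2 := by
  set v := y - x with hv
  have hd : ∀ t : ℝ, HasDerivAt (fun s : ℝ => f (x + s • v)) (inner ℝ (f' (x + t • v)) v) t :=
    fun t => (hf _).hasDerivAt_comp_line
  have hB : ∀ t : ℝ, HasDerivAt
      (fun s : ℝ => f x + s * inner ℝ (f' x) v + L / 2 * ‖v‖ ^ 2 * s ^ 2)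
      (inner ℝ (f' x) v + L * ‖v‖ ^ 2 * t) t := by
    intro t
    have h := (((hasDerivAt_id t).mul_const (inner ℝ (f' x) v)).const_add (f x)).add
      ((hasDerivAt_pow 2 t).const_mul (L / 2 * ‖v‖ ^ 2))
    refine h.congr_deriv ?_
    push_cast
    ring
  have key := image_le_of_deriv_right_le_deriv_boundary (a := 0) (b := 1)
    (fun t _ => (hd t).continuousAt.continuousWithinAt)
    (fun t _ => (hd t).hasDerivWithinAt) (by simp)
    (fun t _ => (hB t).continuousAt.continuousWithinAt)
    (fun t _ => (hB t).hasDerivWithinAt) (fun t ht => ?_)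
    (Set.right_mem_Icc.2 zero_le_one)
  · simp only [one_smul, hv, add_sub_cancel] at key
    linarith
  · have h1 : inner ℝ (f' (x + t • v) - f' x) v ≤ L * ‖v‖ ^ 2 * t := by
      refine (real_inner_le_norm _ _).trans ?_
      have h2 := hL (x + t • v) x
      rw [add_sub_cancel_left, norm_smul, Real.norm_of_nonneg ht.1] at h2
      nlinarith [norm_nonneg v]
    rw [inner_sub_left] at h1
    linarith

theorem ConvexOn.add_inner_le_of_hasGradientAt {f : V → ℝ} {g x : V}
    (hc : ConvexOn ℝ Set.univ f) (hf : HasGradientAt f g x) (y : V) :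
    f x + inner ℝ g (y - x) ≤ f y := by
  have hd : HasDerivAt (fun s : ℝ => f (x + s • (y - x))) (inner ℝ g (y - x)) 0 :=
    HasGradientAt.hasDerivAt_comp_line (by simpa using hf)
  have hcv : ConvexOn ℝ Set.univ (fun s : ℝ => f (x + s • (y - x))) := by
    have h := hc.comp_affineMap (AffineMap.lineMap x y : ℝ →ᵃ[ℝ] V)
    have h' : f ∘ ⇑(AffineMap.lineMap x y : ℝ →ᵃ[ℝ] V) = fun s : ℝ => f (x + s • (y - x)) := by
      ext s
      simp [AffineMap.lineMap_apply, add_comm]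
    rwa [h', Set.preimage_univ] at h
  have h := hcv.le_slope_of_hasDerivAt (Set.mem_univ 0) (Set.mem_univ 1) one_pos hd
  simp [slope_def_field] at h
  linarith

omit [CompleteSpace V] in
theorem StrongConvexOn.sq_le_sub_of_forall_le {f : V → ℝ} {m : ℝ} {x₀ : V}
    (hf : StrongConvexOn Set.univ m f) (hmin : ∀ z, f x₀ ≤ f z) (x : V) :
    m / 2 * ‖x - x₀‖ ^ 2 ≤ f x - f x₀ := by
  have key : ∀ a ∈ Set.Ioo (0 : ℝ) 1, (1 - a) * (m / 2 * ‖x - x₀‖ ^ 2) ≤ f x - f x₀ := by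
    intro a ha
    have h := hf.2 (Set.mem_univ x) (Set.mem_univ x₀) ha.1.le (sub_nonneg.2 ha.2.le)
      (add_sub_cancel a 1)
    have h' := hmin (a • x + (1 - a) • x₀)
    simp only [smul_eq_mul] at h
    refine le_of_mul_le_mul_left ?_ ha.1
    nlinarith
  have hlim : Filter.Tendsto (fun a : ℝ => (1 - a) * (m / 2 * ‖x - x₀‖ ^ 2))
      (nhdsWithin 0 (Set.Ioi 0)) (nhds (m / 2 * ‖x - x₀‖ ^ 2)) := by
    have : Continuous fun a : ℝ => (1 - a) * (m / 2 * ‖x - x₀‖ ^ 2) := by fun_prop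
    simpa using (this.tendsto 0).mono_left nhdsWithin_le_nhds
  exact le_of_tendsto hlim (Filter.mem_of_superset (Ioo_mem_nhdsGT one_pos) key)

/-- First-order optimality of a proximal point. -/
theorem IsMinOn.smul_gradient_eq_of_prox {f : V → ℝ} {g x p : V} {γ : ℝ} (hγ : 0 < γ)
    (hf : HasGradientAt f g p)
    (hp : IsMinOn (fun z => f z + ‖z - x‖ ^ 2 / (2 * γ)) Set.univ p) :
    γ • g = x - p := by
  rw [← sub_eq_zero, ← inner_self_eq_zero (𝕜 := ℝ)]
  set v := γ • g - (x - p) with hv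
  have hd : HasDerivAt (fun s : ℝ => f (p + s • v)) (inner ℝ g v) 0 :=
    HasGradientAt.hasDerivAt_comp_line (by simpa using hf)
  have hl : HasDerivAt (fun s : ℝ => p + s • v - x) v 0 := by
    simpa using (((hasDerivAt_id (0 : ℝ)).smul_const v).const_add p).sub_const x
  have hsum := hd.add (hl.norm_sq.div_const (2 * γ))
  have hmin : IsLocalMin (fun s : ℝ => f (p + s • v) + ‖p + s • v - x‖ ^ 2 / (2 * γ)) 0 :=
    Filter.Eventually.of_forall fun s => by simpa using hp (Set.mem_univ (p + s • v))
  have h0 := hmin.hasDerivAt_eq_zero hsum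
  simp only [zero_smul, add_zero] at h0
  have h1 : inner ℝ v v = γ * inner ℝ g v + inner ℝ (p - x) v := by
    conv_lhs => rw [hv, inner_sub_left, real_inner_smul_left, ← hv]
    rw [← neg_sub p x, inner_neg_left]
    ring
  rw [h1]
  field_simp at h0
  linarith

theorem sq_norm_gradient_le_of_forall_le {f : V → ℝ} {f' : V → V} {L : ℝ} {x₀ : V} (hLpos : 0 < L)
    (hf : ∀ x, HasGradientAt f (f' x) x) (hL : ∀ x y, ‖f' x - f' y‖ ≤ L * ‖x - y‖)
    (hmin : ∀ z, f x₀ ≤ f z) (x : V) :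
    ‖f' x‖ ^ 2 ≤ 2 * L * (f x - f x₀) := by
  have h := le_add_inner_add_sq_of_lipschitz_gradient hf hL x (x - L⁻¹ • f' x)
  have h' := hmin (x - L⁻¹ • f' x)
  rw [sub_sub_cancel_left, inner_neg_right, real_inner_smul_right, real_inner_self_eq_norm_sq,
    norm_neg, norm_smul, Real.norm_of_nonneg (inv_nonneg.2 hLpos.le), mul_pow] at h
  have h2 : L / 2 * (L⁻¹ ^ 2 * ‖f' x‖ ^ 2) = L⁻¹ / 2 * ‖f' x‖ ^ 2 := by field_simp
  rw [h2] at h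
  have h3 : L⁻¹ / 2 * ‖f' x‖ ^ 2 ≤ f x - f x₀ := by linarith
  have h4 := mul_le_mul_of_nonneg_left h3 (by positivity : (0 : ℝ) ≤ 2 * L)
  have h5 : 2 * L * (L⁻¹ / 2 * ‖f' x‖ ^ 2) = ‖f' x‖ ^ 2 := by field_simp
  linarith

section Envelope

variable {f : V → ℝ} {f' : V → V} {L γ : ℝ} {x₀ x p : V}

theorem prox_sq_norm_sub_le_envelope (hγ : 0 < γ) (hLpos : 0 < L)
    (hf : ∀ x, HasGradientAt f (f' x) x) (hL : ∀ x y, ‖f' x - f' y‖ ≤ L * ‖x - y‖)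
    (hmin : ∀ z, f x₀ ≤ f z)
    (hp : IsMinOn (fun z => f z + ‖z - x‖ ^ 2 / (2 * γ)) Set.univ p) :
    (1 + γ * L) * ‖x - p‖ ^ 2 ≤ 2 * (γ * L) * (γ * (f p - f x₀) + ‖x - p‖ ^ 2 / 2) := by
  have h := sq_norm_gradient_le_of_forall_le hLpos hf hL hmin p
  rw [← hp.smul_gradient_eq_of_prox hγ (hf p), norm_smul, Real.norm_of_nonneg hγ.le]
  nlinarith [mul_le_mul_of_nonneg_left h (sq_nonneg γ)]

theorem sub_le_envelope (hγ : 0 < γ) (hLpos : 0 < L)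
    (hf : ∀ x, HasGradientAt f (f' x) x) (hL : ∀ x y, ‖f' x - f' y‖ ≤ L * ‖x - y‖)
    (hmin : ∀ z, f x₀ ≤ f z)
    (hp : IsMinOn (fun z => f z + ‖z - x‖ ^ 2 / (2 * γ)) Set.univ p) :
    γ * (f x - f x₀) ≤ (1 + γ * L) * (γ * (f p - f x₀) + ‖x - p‖ ^ 2 / 2) := by
  have h := prox_sq_norm_sub_le_envelope hγ hLpos hf hL hmin hp
  have h' := le_add_inner_add_sq_of_lipschitz_gradient hf hL p x
  have h2 : γ * inner ℝ (f' p) (x - p) = ‖x - p‖ ^ 2 := by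
    rw [← real_inner_smul_left, hp.smul_gradient_eq_of_prox hγ (hf p), real_inner_self_eq_norm_sq]
  nlinarith [mul_le_mul_of_nonneg_left h' hγ.le]

theorem envelope_le_inner (hγ : 0 < γ) (hc : ConvexOn ℝ Set.univ f)
    (hf : ∀ x, HasGradientAt f (f' x) x)
    (hp : IsMinOn (fun z => f z + ‖z - x‖ ^ 2 / (2 * γ)) Set.univ p) (y : V) :
    γ * (f p - f y) + ‖x - p‖ ^ 2 / 2 ≤ inner ℝ (x - p) (x - y) := by
  have h := mul_le_mul_of_nonneg_left (hc.add_inner_le_of_hasGradientAt (hf p) y) hγ.le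
  rw [mul_add, ← real_inner_smul_left, hp.smul_gradient_eq_of_prox hγ (hf p)] at h
  have h2 : inner ℝ (x - p) (x - y) = ‖x - p‖ ^ 2 - inner ℝ (x - p) (y - p) := by
    rw [← real_inner_self_eq_norm_sq, ← inner_sub_right, sub_sub_sub_cancel_right]
  nlinarith [sq_nonneg ‖x - p‖]

end Envelope

end Gradient

theorem sq_norm_average_le {V : Type*} [NormedAddCommGroup V] [InnerProductSpace ℝ V] {n : ℕ}
    (v : Fin n → V) :
    ‖(1 / (n : ℝ)) • ∑ i, v i‖ ^ 2 ≤ (1 / (n : ℝ)) * ∑ i, ‖v i‖ ^ 2 := by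
  rcases Nat.eq_zero_or_pos n with rfl | hn
  · simp
  have hn' : (0 : ℝ) < n := Nat.cast_pos.2 hn
  have h1 : ‖∑ i, v i‖ ^ 2 ≤ n * ∑ i, ‖v i‖ ^ 2 := by
    calc ‖∑ i, v i‖ ^ 2 ≤ (∑ i, ‖v i‖) ^ 2 := by gcongr; exact norm_sum_le _ _
      _ ≤ n * ∑ i, ‖v i‖ ^ 2 := by
        simpa using sq_sum_le_card_mul_sum_sq (s := Finset.univ) (f := fun i => ‖v i‖)
  rw [norm_smul, mul_pow, Real.norm_of_nonneg (by positivity)]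
  calc (1 / (n : ℝ)) ^ 2 * ‖∑ i, v i‖ ^ 2
      ≤ (1 / (n : ℝ)) ^ 2 * (n * ∑ i, ‖v i‖ ^ 2) := by gcongr
    _ = (1 / (n : ℝ)) * ∑ i, ‖v i‖ ^ 2 := by field_simp

/-- One step of biased gradient descent contracts the function gap `D` when the gradient `h`
satisfies a Polyak–Łojasiewicz type bound and the bias `g - h` is relatively small. -/
theorem biased_descent_step {V : Type*} [NormedAddCommGroup V] [InnerProductSpace ℝ V]
    {h g v : V} {D D' S s L μ γ Λ α : ℝ}
    (hs : 0 ≤ s) (hL : 0 < L) (hμ : 0 < μ) (hμL : μ ≤ L) (hγ : 0 < γ) (hΛ : 0 < Λ) (hα : 0 < α)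
    (hsL : 2 * s * L < μ)
    (hαle : α ≤ (1 / (γ * Λ)) * ((μ - 2 * s * L) / (μ + 4 * s * L + 4 * s ^ 2 * L)))
    (hD : 0 ≤ D) (hDv : D ≤ inner ℝ h v) (hgrowth : γ * μ * ‖v‖ ^ 2 ≤ 2 * (1 + γ * L) * D)
    (hbias : ‖g - h‖ ^ 2 ≤ s ^ 2 * S) (hS : (1 + γ * L) * S ≤ 2 * (γ * L) * D)
    (hdesc : D' ≤ D - α * inner ℝ h g + γ * Λ / 2 * (α ^ 2 * ‖g‖ ^ 2)) :
    D' ≤ (1 - α * (γ * (μ - 2 * s * L) / (4 * (1 + γ * L)))) * D := by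
  have hq : 0 < 1 + γ * L := by positivity
  have hPL : γ * μ * D ≤ 2 * (1 + γ * L) * ‖h‖ ^ 2 := by
    rcases hD.eq_or_lt with h0 | hpos
    · rw [← h0, mul_zero]; positivity
    refine le_of_mul_le_mul_right ?_ hpos
    have h1 : D ^ 2 ≤ (‖h‖ * ‖v‖) ^ 2 := by
      gcongr; exact hDv.trans (real_inner_le_norm _ _)
    calc γ * μ * D * D = γ * μ * D ^ 2 := by ring
      _ ≤ γ * μ * (‖h‖ * ‖v‖) ^ 2 := by gcongr
      _ = ‖h‖ ^ 2 * (γ * μ * ‖v‖ ^ 2) := by ring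
      _ ≤ ‖h‖ ^ 2 * (2 * (1 + γ * L) * D) := by gcongr
      _ = _ := by ring
  set e := g - h with he
  have he2 : μ * ‖e‖ ^ 2 ≤ 4 * s ^ 2 * L * ‖h‖ ^ 2 := by
    refine le_of_mul_le_mul_left ?_ hq
    calc (1 + γ * L) * (μ * ‖e‖ ^ 2) ≤ (1 + γ * L) * (μ * (s ^ 2 * S)) := by gcongr
      _ = μ * s ^ 2 * ((1 + γ * L) * S) := by ring
      _ ≤ μ * s ^ 2 * (2 * (γ * L) * D) := by gcongr
      _ = 2 * s ^ 2 * L * (γ * μ * D) := by ring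
      _ ≤ 2 * s ^ 2 * L * (2 * (1 + γ * L) * ‖h‖ ^ 2) := by gcongr
      _ = _ := by ring
  have he1 : μ * ‖e‖ ≤ 2 * s * L * ‖h‖ := by
    refine le_of_sq_le_sq ?_ (by positivity)
    calc (μ * ‖e‖) ^ 2 = μ * (μ * ‖e‖ ^ 2) := by ring
      _ ≤ L * (4 * s ^ 2 * L * ‖h‖ ^ 2) := by gcongr
      _ = _ := by ring
  have hge : g = h + e := by rw [he]; abel
  have hin : (μ - 2 * s * L) * ‖h‖ ^ 2 ≤ μ * inner ℝ h g := by
    have h1 : -(‖h‖ * ‖e‖) ≤ inner ℝ h e := (abs_le.1 (abs_real_inner_le_norm h e)).1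
    rw [hge, inner_add_right, real_inner_self_eq_norm_sq]
    nlinarith [mul_le_mul_of_nonneg_left he1 (norm_nonneg h),
      mul_le_mul_of_nonneg_left h1 hμ.le]
  have hgn : μ * ‖g‖ ^ 2 ≤ (μ + 4 * s * L + 4 * s ^ 2 * L) * ‖h‖ ^ 2 := by
    have h1 : ‖g‖ ≤ ‖h‖ + ‖e‖ := hge ▸ norm_add_le h e
    have h2 : ‖g‖ ^ 2 ≤ (‖h‖ + ‖e‖) ^ 2 := by gcongr
    nlinarith [mul_le_mul_of_nonneg_left he1 (norm_nonneg h),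
      mul_le_mul_of_nonneg_left h2 hμ.le]
  have hα' : α * (γ * Λ) * (μ + 4 * s * L + 4 * s ^ 2 * L) ≤ μ - 2 * s * L := by
    have hB : 0 < μ + 4 * s * L + 4 * s ^ 2 * L := by positivity
    rw [div_mul_div_comm, one_mul, le_div_iff₀ (by positivity)] at hαle
    linarith
  have hmain : μ * D' ≤ μ * D - α / 2 * (μ - 2 * s * L) * ‖h‖ ^ 2 := by
    have h1 := mul_le_mul_of_nonneg_left hdesc hμ.le
    have h2 := mul_le_mul_of_nonneg_left hin hα.le
    have h3 := mul_le_mul_of_nonneg_left hgn (by positivity : 0 ≤ γ * Λ / 2 * α ^ 2)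
    have h4 := mul_le_mul_of_nonneg_left hα' (by positivity : 0 ≤ α / 2 * ‖h‖ ^ 2)
    nlinarith
  have hfin : μ * (α * (γ * (μ - 2 * s * L) / (4 * (1 + γ * L))) * D)
      ≤ α / 2 * (μ - 2 * s * L) * ‖h‖ ^ 2 := by
    have h1 : γ * μ * D / (2 * (1 + γ * L)) ≤ ‖h‖ ^ 2 := by
      rw [div_le_iff₀ (by positivity)]; linarith
    have h2 : 0 ≤ α / 2 * (μ - 2 * s * L) := mul_nonneg (by positivity) (by linarith)
    refine le_trans (le_of_eq ?_) (mul_le_mul_of_nonneg_left h1 h2)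
    field_simp
    ring
  refine le_of_mul_le_mul_left ?_ hμ
  linarith

theorem le_pow_mul_of_step {D : ℕ → ℝ} {q : ℝ} (hD : ∀ k, 0 ≤ D k)
    (hstep : ∀ k, D (k + 1) ≤ q * D k) (K : ℕ) : D K ≤ q ^ K * D 0 := by
  rcases le_or_gt 0 q with hq | hq
  · induction K with
    | zero => simp
    | succ k ih =>
      calc D (k + 1) ≤ q * D k := hstep k
        _ ≤ q * (q ^ k * D 0) := by gcongr
        _ = _ := by ring
  · have h0 : ∀ k, D k = 0 := fun k => by nlinarith [hD k, hD (k + 1), hstep k]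
    simp [h0]

theorem fedexprox_rel_sgd_E
    {d n : ℕ} (hn : 1 ≤ n)
    (f : Fin n → EuclideanSpace ℝ (Fin d) → ℝ)
    (f' : Fin n → EuclideanSpace ℝ (Fin d) → EuclideanSpace ℝ (Fin d))
    (L : Fin n → ℝ) (hLpos : ∀ i, 0 < L i)
    (hdiff : ∀ i x, HasGradientAt (f i) (f' i x) x)
    (hconv : ∀ i, ConvexOn ℝ Set.univ (f i))
    (hsmooth : ∀ i x y, ‖f' i x - f' i y‖ ≤ L i * ‖x - y‖)
    (Lmax : ℝ) (hLmax : IsGreatest (Set.range L) Lmax)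
    (xstar : EuclideanSpace ℝ (Fin d)) (hinterp : ∀ i, f' i xstar = 0)
    (μ : ℝ) (hμ : 0 < μ)
    (hsc : StrongConvexOn Set.univ μ (fun x => (1 / (n : ℝ)) * ∑ i, f i x))
    (γ : ℝ) (hγ : 0 < γ)
    (prox : Fin n → EuclideanSpace ℝ (Fin d) → EuclideanSpace ℝ (Fin d))
    (hprox : ∀ i x, IsMinOn (fun z => f i z + ‖z - x‖ ^ 2 / (2 * γ)) Set.univ (prox i x))
    (hproxu : ∀ i x q, IsMinOn (fun z => f i z + ‖z - x‖ ^ 2 / (2 * γ)) Set.univ q → q = prox i x)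
    (M : EuclideanSpace ℝ (Fin d) → ℝ)
    (hM : ∀ x, M x = (1 / (n : ℝ)) * ∑ i, (f i (prox i x) + ‖prox i x - x‖ ^ 2 / (2 * γ)))
    (M' : EuclideanSpace ℝ (Fin d) → EuclideanSpace ℝ (Fin d))
    (hM' : ∀ x, M' x = (1 / ((n : ℝ) * γ)) • ∑ i, (x - prox i x))
    (hMdiff : ∀ x, HasGradientAt M (M' x) x)
    (Minf : ℝ) (hMinf : Minf = M xstar) (hMinfLB : ∀ x, Minf ≤ M x)
    (Lγ : ℝ) (hLγ : 0 < Lγ)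
    (hMLip : ∀ x y, ‖M' x - M' y‖ ≤ Lγ * ‖x - y‖)
    (α : ℝ)
    (xseq : ℕ → EuclideanSpace ℝ (Fin d))
    (xtil : Fin n → ℕ → EuclideanSpace ℝ (Fin d))
    (hrec : ∀ k : ℕ, xseq (k + 1) = xseq k + α • ((1 / (n : ℝ)) • (∑ i, xtil i k) - xseq k))
    (ε₂ : ℝ) (hε₂ : 0 ≤ ε₂)
    (happrox : ∀ (i : Fin n) (k : ℕ),
      ‖xtil i k - prox i (xseq k)‖ ^ 2 ≤ ε₂ * ‖xseq k - prox i (xseq k)‖ ^ 2)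
    (hε₂lt : ε₂ < μ ^ 2 / (4 * Lmax ^ 2))
    (hα : 0 < α)
    (hαle : α ≤ (1 / (γ * Lγ)) * ((μ - 2 * Real.sqrt ε₂ * Lmax) / (μ + 4 * Real.sqrt ε₂ * Lmax + 4 * ε₂ * Lmax)))
    : ∀ K : ℕ,
      γ * M (xseq K) - γ * Minf ≤
        (1 - α * (γ * (μ - 2 * Real.sqrt ε₂ * Lmax) / (4 * (1 + γ * Lmax)))) ^ K *
          (γ * M (xseq 0) - γ * Minf) := by
  have hn0 : (0 : ℝ) < n := by exact_mod_cast hn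
  have hn1 : (n : ℝ) * (1 / n) = 1 := mul_one_div_cancel hn0.ne'
  have hLle : ∀ i, L i ≤ Lmax := fun i => hLmax.2 ⟨i, rfl⟩
  obtain ⟨i₀, hi₀⟩ := hLmax.1
  have hL0 : 0 < Lmax := hi₀ ▸ hLpos i₀
  have hLip : ∀ i x y, ‖f' i x - f' i y‖ ≤ Lmax * ‖x - y‖ := fun i x y =>
    (hsmooth i x y).trans (mul_le_mul_of_nonneg_right (hLle i) (norm_nonneg _))
  have hmin : ∀ i z, f i xstar ≤ f i z := fun i z => by
    simpa [hinterp i] using (hconv i).add_inner_le_of_hasGradientAt (hdiff i xstar) z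
  have hproxstar : ∀ i, prox i xstar = xstar := fun i => by
    refine (hproxu i xstar xstar fun z _ => ?_).symm
    have h := hmin i z
    have h' : 0 ≤ ‖z - xstar‖ ^ 2 / (2 * γ) := by positivity
    simp only [Set.mem_ofPred_eq, sub_self, norm_zero]
    norm_num
    linarith
  have hMgap : ∀ x, γ * M x - γ * Minf = (1 / (n : ℝ)) *
      ∑ i, (γ * (f i (prox i x) - f i xstar) + ‖x - prox i x‖ ^ 2 / 2) := fun x => by
    rw [hMinf, hM, hM, mul_left_comm, mul_left_comm γ (1 / (n : ℝ)), ← mul_sub, ← mul_sub,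
      ← Finset.sum_sub_distrib, Finset.mul_sum]
    congr 1
    refine Finset.sum_congr rfl fun i _ => ?_
    rw [hproxstar, sub_self, norm_zero, norm_sub_rev]
    field_simp
    ring
  have hgap0 : ∀ x, 0 ≤ γ * M x - γ * Minf := fun x =>
    sub_nonneg.2 (mul_le_mul_of_nonneg_left (hMinfLB x) hγ.le)
  have havg : ∀ u w : Fin n → ℝ, (∀ i, u i ≤ w i) →
      (1 / (n : ℝ)) * ∑ i, u i ≤ (1 / (n : ℝ)) * ∑ i, w i := fun u w h =>
    mul_le_mul_of_nonneg_left (Finset.sum_le_sum fun i _ => h i) (by positivity)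
  have havg' : ∀ (a b : ℝ) (u w : Fin n → ℝ), (∀ i, a * u i ≤ b * w i) →
      a * ((1 / (n : ℝ)) * ∑ i, u i) ≤ b * ((1 / (n : ℝ)) * ∑ i, w i) := fun a b u w h => by
    rw [mul_left_comm, mul_left_comm b, Finset.mul_sum _ _ a, Finset.mul_sum _ _ b]
    exact havg _ _ h
  set F : EuclideanSpace ℝ (Fin d) → ℝ := fun x => (1 / (n : ℝ)) * ∑ i, f i x with hF
  have hFgap : ∀ x, μ / 2 * ‖x - xstar‖ ^ 2 ≤ F x - F xstar :=
    hsc.sq_le_sub_of_forall_le fun z => havg _ _ fun i => hmin i z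
  have hFsub : ∀ x, F x - F xstar = (1 / (n : ℝ)) * ∑ i, (f i x - f i xstar) := fun x => by
    rw [hF, Finset.sum_sub_distrib, mul_sub]
  have hFub : ∀ x, F x - F xstar ≤ Lmax / 2 * ‖x - xstar‖ ^ 2 := fun x => by
    rw [hFsub]
    refine (havg _ (fun _ => Lmax / 2 * ‖x - xstar‖ ^ 2) fun i => ?_).trans_eq ?_
    · have h := le_add_inner_add_sq_of_lipschitz_gradient (hdiff i) (hLip i) xstar x
      rw [hinterp, inner_zero_left] at h
      linarith
    · rw [Finset.sum_const, Finset.card_univ, Fintype.card_fin, nsmul_eq_mul]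
      field_simp
  refine le_pow_mul_of_step (D := fun k => γ * M (xseq k) - γ * Minf) (fun k => hgap0 _) fun k => ?_
  rcases lt_or_ge Lmax μ with hlt | hμL
  · have hstar : ∀ x, x = xstar := fun x => by
      have h := (hFgap x).trans (hFub x)
      have h2 : ‖x - xstar‖ ^ 2 = 0 := by nlinarith [sq_nonneg ‖x - xstar‖]
      simpa [sub_eq_zero] using h2
    simp [hstar (xseq k), hstar (xseq (k + 1)), hMinf]
  have hs2 : Real.sqrt ε₂ ^ 2 = ε₂ := Real.sq_sqrt hε₂
  set s := Real.sqrt ε₂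
  have hs0 : 0 ≤ s := Real.sqrt_nonneg _
  have hsL : 2 * s * Lmax < μ := by
    rw [lt_div_iff₀ (by positivity), ← hs2] at hε₂lt
    refine lt_of_pow_lt_pow_left₀ 2 hμ.le ?_
    linarith
  rw [← hs2] at hαle
  set x := xseq k
  set h : EuclideanSpace ℝ (Fin d) := (1 / (n : ℝ)) • ∑ i, (x - prox i x) with hh
  set g : EuclideanSpace ℝ (Fin d) := x - (1 / (n : ℝ)) • ∑ i, xtil i k with hg
  have hM'h : γ • M' x = h := by
    rw [hM', hh, smul_smul]
    congr 1
    field_simp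
  refine biased_descent_step (h := h) (g := g) (v := x - xstar)
    (S := (1 / (n : ℝ)) * ∑ i, ‖x - prox i x‖ ^ 2)
    hs0 hL0 hμ hμL hγ hLγ hα hsL hαle (hgap0 _) ?_ ?_ ?_ ?_ ?_
  · rw [hMgap, hh, real_inner_smul_left, sum_inner]
    exact havg _ _ fun i => envelope_le_inner hγ (hconv i) (hdiff i) (hprox i x) xstar
  · have h1 := mul_le_mul_of_nonneg_left (hFgap x) hγ.le
    have h2 : γ * (F x - F xstar) ≤ (1 + γ * Lmax) * (γ * M x - γ * Minf) := by
      rw [hFsub, hMgap]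
      exact havg' _ _ _ _ fun i => sub_le_envelope hγ hL0 (hdiff i) (hLip i) (hmin i) (hprox i x)
    linarith
  · have h1 : g - h = (1 / (n : ℝ)) • ∑ i, (prox i x - xtil i k) := by
      rw [hg, hh, Finset.sum_sub_distrib, Finset.sum_sub_distrib, Finset.sum_const,
        Finset.card_univ, Fintype.card_fin, ← Nat.cast_smul_eq_nsmul ℝ, smul_sub, smul_sub, smul_smul,
        mul_comm, hn1, one_smul]
      abel
    rw [h1, hs2]
    refine (sq_norm_average_le _).trans ?_
    rw [← one_mul (1 / (n : ℝ) * ∑ i, ‖prox i x - xtil i k‖ ^ 2)]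
    refine havg' _ _ _ _ fun i => ?_
    rw [one_mul, norm_sub_rev]
    exact happrox i k
  · rw [hMgap]
    exact havg' _ _ _ _ fun i =>
      prox_sq_norm_sub_le_envelope hγ hL0 (hdiff i) (hLip i) (hmin i) (hprox i x)
  · have h1 := mul_le_mul_of_nonneg_left
      (le_add_inner_add_sq_of_lipschitz_gradient hMdiff hMLip x (xseq (k + 1))) hγ.le
    have h2 : xseq (k + 1) - x = -(α • g) := by
      rw [hrec k, add_sub_cancel_left, hg, ← smul_neg, neg_sub]
    rw [h2, mul_add, mul_add, ← real_inner_smul_left, hM'h, inner_neg_right, real_inner_smul_right,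
      norm_neg, norm_smul, mul_pow, Real.norm_of_nonneg hα.le] at h1
    linarith
end

section
/- Suppose every approximate proximal point used by inexact FedExProx is an ε₂-relative approximation, i.e., ‖x̃_{i,k+1} − prox_{γf_i}(x_k)‖² ≤ ε₂ · ‖x_k − prox_{γf_i}(x_k)‖² for all i and k, where 0 ≤ ε₂ < μ/(4L_max). Then for any constant extrapolation parameter α with 0 < α ≤ 1/(γL_γ), the iterates satisfy E_K ≤ (1 − (1 − 4ε₂L_max/μ) · (γμ/(4(1 + γL_max))) · α)^K · E_0 for every K ≥ 0. -/
open scoped InnerProductSpace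

section GradientInequalities

variable {E : Type*} [NormedAddCommGroup E] [InnerProductSpace ℝ E]

theorem StrongConvexOn.add_sq_le_of_le {f : E → ℝ} {m : ℝ} (hf : StrongConvexOn Set.univ m f)
    {x₀ : E} (hmin : ∀ x, f x₀ ≤ f x) (x : E) : f x₀ + m / 2 * ‖x - x₀‖ ^ 2 ≤ f x := by
  have key : ∀ t : ℝ, t ∈ Set.Ioo (0 : ℝ) 1 →
      f x₀ + (1 - t) * (m / 2 * ‖x - x₀‖ ^ 2) ≤ f x := fun t ht => by
    have h := hf.2 (Set.mem_univ x) (Set.mem_univ x₀) ht.1.le (sub_nonneg.2 ht.2.le) (by ring)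
    have h' := hmin (t • x + (1 - t) • x₀)
    simp only [smul_eq_mul] at h
    have h2 : t * (f x₀ + (1 - t) * (m / 2 * ‖x - x₀‖ ^ 2)) ≤ t * f x := by linarith
    exact le_of_mul_le_mul_left h2 ht.1
  have hlim : Filter.Tendsto (fun t : ℝ => f x₀ + (1 - t) * (m / 2 * ‖x - x₀‖ ^ 2))
      (nhdsWithin 0 (Set.Ioi 0)) (nhds (f x₀ + (1 - 0) * (m / 2 * ‖x - x₀‖ ^ 2))) :=
    (Continuous.tendsto (by fun_prop) 0).mono_left nhdsWithin_le_nhds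
  have h := le_of_tendsto hlim
    (Filter.eventually_of_mem (Ioo_mem_nhdsGT one_pos) key)
  simpa using h

theorem norm_average_sq_le {n : ℕ} (hn : 1 ≤ n) (v : Fin n → E) :
    ‖(1 / (n : ℝ)) • ∑ i, v i‖ ^ 2 ≤ (1 / (n : ℝ)) * ∑ i, ‖v i‖ ^ 2 := by
  have hn' : (0 : ℝ) < n := by exact_mod_cast hn
  have h1 : ‖∑ i, v i‖ ^ 2 ≤ n * ∑ i, ‖v i‖ ^ 2 := by
    calc ‖∑ i, v i‖ ^ 2 ≤ (∑ i, ‖v i‖) ^ 2 := by gcongr; exact norm_sum_le _ _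
      _ ≤ n * ∑ i, ‖v i‖ ^ 2 := by
        simpa using sq_sum_le_card_mul_sum_sq (s := Finset.univ) (f := fun i => ‖v i‖)
  rw [norm_smul, Real.norm_of_nonneg (by positivity), mul_pow]
  calc (1 / (n : ℝ)) ^ 2 * ‖∑ i, v i‖ ^ 2
      ≤ (1 / (n : ℝ)) ^ 2 * (n * ∑ i, ‖v i‖ ^ 2) := by gcongr
    _ = (1 / (n : ℝ)) * ∑ i, ‖v i‖ ^ 2 := by field_simp

variable [CompleteSpace E]

theorem HasGradientAt.hasDerivAt_line {f : E → ℝ} {g x v : E} {t : ℝ}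
    (h : HasGradientAt f g (x + t • v)) :
    HasDerivAt (fun s : ℝ => f (x + s • v)) ⟪g, v⟫_ℝ t := by
  have hline : HasDerivAt (fun s : ℝ => x + s • v) v t := by
    simpa using ((hasDerivAt_id t).smul_const v).const_add x
  exact (h.hasFDerivAt.comp_hasDerivAt t hline).congr_deriv (by simp)

theorem ConvexOn.add_inner_gradient_le {f : E → ℝ} (hf : ConvexOn ℝ Set.univ f) {g x : E}
    (hg : HasGradientAt f g x) (y : E) : f x + ⟪g, y - x⟫_ℝ ≤ f y := by
  have hline : ConvexOn ℝ Set.univ (fun s : ℝ => f (x + s • (y - x))) := by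
    have h := hf.comp_affineMap (AffineMap.lineMap x y)
    refine h.congr fun s _ => ?_
    simp [AffineMap.lineMap_apply, add_comm]
  have hderiv : HasDerivAt (fun s : ℝ => f (x + s • (y - x))) ⟪g, y - x⟫_ℝ 0 :=
    HasGradientAt.hasDerivAt_line (by simpa using hg)
  have h := hline.le_slope_of_hasDerivAt (Set.mem_univ 0) (Set.mem_univ 1) one_pos hderiv
  simp [slope_def_field] at h
  linarith

theorem le_add_inner_gradient_add_sq {f : E → ℝ} {f' : E → E} {L : ℝ}
    (hf : ∀ x, HasGradientAt f (f' x) x) (hL : ∀ x y, ‖f' x - f' y‖ ≤ L * ‖x - y‖) (x y : E) :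
    f y ≤ f x + ⟪f' x, y - x⟫_ℝ + L / 2 * ‖y - x‖ ^ 2 := by
  set v := y - x with hv
  have hderiv : ∀ t : ℝ, HasDerivAt (fun s : ℝ => f (x + s • v)) ⟪f' (x + t • v), v⟫_ℝ t :=
    fun t => (hf _).hasDerivAt_line
  have hB : ∀ t : ℝ, HasDerivAt
      (fun s : ℝ => f x + s * ⟪f' x, v⟫_ℝ + L / 2 * ‖v‖ ^ 2 * s ^ 2)
      (⟪f' x, v⟫_ℝ + L * ‖v‖ ^ 2 * t) t := fun t => by
    have h := (((hasDerivAt_id t).mul_const ⟪f' x, v⟫_ℝ).const_add (f x)).add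
      (((hasDerivAt_id t).pow 2).const_mul (L / 2 * ‖v‖ ^ 2))
    exact h.congr_deriv (by simp; ring)
  have h := image_le_of_deriv_right_le_deriv_boundary (a := (0 : ℝ)) (b := 1)
    (fun t _ => (hderiv t).continuousAt.continuousWithinAt)
    (fun t _ => (hderiv t).hasDerivWithinAt) (by simp)
    (fun t _ => (hB t).continuousAt.continuousWithinAt)
    (fun t _ => (hB t).hasDerivWithinAt)
    (fun t ht => by
      have h1 : ⟪f' (x + t • v) - f' x, v⟫_ℝ ≤ L * ‖v‖ ^ 2 * t :=
        calc ⟪f' (x + t • v) - f' x, v⟫_ℝ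
            ≤ ‖f' (x + t • v) - f' x‖ * ‖v‖ := real_inner_le_norm _ _
          _ ≤ (L * ‖x + t • v - x‖) * ‖v‖ := by gcongr; exact hL _ _
          _ = L * ‖v‖ ^ 2 * t := by
            rw [add_sub_cancel_left, norm_smul, Real.norm_of_nonneg ht.1]; ring
      rw [inner_sub_left] at h1
      linarith)
    (Set.right_mem_Icc.2 zero_le_one)
  simpa [hv] using h

theorem norm_gradient_sq_le_of_isMinOn {f : E → ℝ} {f' : E → E} {L : ℝ} (hLpos : 0 < L)
    (hf : ∀ x, HasGradientAt f (f' x) x) (hL : ∀ x y, ‖f' x - f' y‖ ≤ L * ‖x - y‖) {m : ℝ}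
    (hm : ∀ x, m ≤ f x) (x : E) : ‖f' x‖ ^ 2 ≤ 2 * L * (f x - m) := by
  have h := le_add_inner_gradient_add_sq hf hL x (x - L⁻¹ • f' x)
  have h' := hm (x - L⁻¹ • f' x)
  rw [sub_sub_cancel_left, inner_neg_right, real_inner_smul_right, real_inner_self_eq_norm_sq,
    norm_neg, norm_smul, Real.norm_of_nonneg (inv_nonneg.2 hLpos.le)] at h
  have h2 : L / 2 * (L⁻¹ * ‖f' x‖) ^ 2 = L⁻¹ * ‖f' x‖ ^ 2 / 2 := by field_simp
  have h3 : L⁻¹ * ‖f' x‖ ^ 2 ≤ 2 * (f x - m) := by linarith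
  rw [inv_mul_le_iff₀ hLpos] at h3
  linarith

theorem gradient_eq_of_isMinOn_prox {f : E → ℝ} {g x p : E} {γ : ℝ}
    (hg : HasGradientAt f g p)
    (hp : IsMinOn (fun z => f z + ‖z - x‖ ^ 2 / (2 * γ)) Set.univ p) :
    g = γ⁻¹ • (x - p) := by
  have h : ∀ v : E, ⟪g - γ⁻¹ • (x - p), v⟫_ℝ = 0 := fun v => by
    have hline : HasDerivAt (fun s : ℝ => p + s • v - x) v 0 := by
      simpa using (((hasDerivAt_id (0 : ℝ)).smul_const v).const_add p).sub_const x
    have hg' : HasGradientAt f g (p + (0 : ℝ) • v) := by simpa using hg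
    have hd := hg'.hasDerivAt_line.add (hline.norm_sq.div_const (2 * γ))
    have hmin : IsLocalMin (fun s : ℝ => f (p + s • v) + ‖p + s • v - x‖ ^ 2 / (2 * γ)) 0 :=
      Filter.Eventually.of_forall fun s => by
        simpa using isMinOn_iff.1 hp (p + s • v) (Set.mem_univ _)
    have h0 := hmin.hasDerivAt_eq_zero hd
    rw [inner_sub_left, real_inner_smul_left, ← neg_sub p x, inner_neg_left]
    simp only [zero_smul, add_zero] at h0
    rw [← h0]
    ring
  exact sub_eq_zero.1 (inner_self_eq_zero.1 (h _))

/-- One step of gradient descent with a perturbed gradient. -/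
theorem perturbed_gradient_step_le {f : E → ℝ} {f' : E → E} {L η : ℝ}
    (hf : ∀ x, HasGradientAt f (f' x) x) (hL : ∀ x y, ‖f' x - f' y‖ ≤ L * ‖x - y‖)
    (hη : 0 ≤ η) (hηL : η * L ≤ 1) (x e : E) :
    f (x - η • (f' x - e)) ≤ f x - η / 2 * ‖f' x‖ ^ 2 + η / 2 * ‖e‖ ^ 2 := by
  have h := le_add_inner_gradient_add_sq hf hL x (x - η • (f' x - e))
  rw [sub_sub_cancel_left, inner_neg_right, real_inner_smul_right, norm_neg, norm_smul,
    Real.norm_of_nonneg hη, inner_sub_right, real_inner_self_eq_norm_sq, mul_pow,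
    norm_sub_sq_real] at h
  have h2 : η * L * (η * (‖f' x‖ ^ 2 - 2 * ⟪f' x, e⟫_ℝ + ‖e‖ ^ 2)) ≤
      1 * (η * (‖f' x‖ ^ 2 - 2 * ⟪f' x, e⟫_ℝ + ‖e‖ ^ 2)) := by
    refine mul_le_mul_of_nonneg_right hηL (mul_nonneg hη ?_)
    rw [← norm_sub_sq_real]
    positivity
  linarith

theorem norm_sub_prox_sq_le {f : E → ℝ} {f' : E → E} {L γ m : ℝ} (hLpos : 0 < L) (hγ : 0 < γ)
    (hf : ∀ x, HasGradientAt f (f' x) x) (hL : ∀ x y, ‖f' x - f' y‖ ≤ L * ‖x - y‖)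
    (hm : ∀ x, m ≤ f x) {x p : E} (hp : f' p = γ⁻¹ • (x - p)) :
    ‖x - p‖ ^ 2 ≤ 2 * L * γ ^ 2 * (f p - m) := by
  have h := norm_gradient_sq_le_of_isMinOn hLpos hf hL hm p
  rw [hp, norm_smul, Real.norm_of_nonneg (inv_nonneg.2 hγ.le), mul_pow, inv_pow,
    inv_mul_le_iff₀ (by positivity)] at h
  linarith

theorem le_mul_moreau {f : E → ℝ} {f' : E → E} {L γ m : ℝ} (hLpos : 0 < L) (hγ : 0 < γ)
    (hf : ∀ x, HasGradientAt f (f' x) x) (hL : ∀ x y, ‖f' x - f' y‖ ≤ L * ‖x - y‖)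
    (hm : ∀ x, m ≤ f x) {x p : E} (hp : f' p = γ⁻¹ • (x - p)) :
    f x - m ≤ (1 + γ * L) * (f p + ‖p - x‖ ^ 2 / (2 * γ) - m) := by
  have h1 := norm_sub_prox_sq_le hLpos hγ hf hL hm hp
  have h2 := le_add_inner_gradient_add_sq hf hL p x
  rw [hp, real_inner_smul_left, real_inner_self_eq_norm_sq] at h2
  rw [norm_sub_rev p x]
  have h3 : ‖x - p‖ ^ 2 / (2 * γ) ≤ γ * L * (f p - m) := by
    rw [div_le_iff₀ (by positivity)]
    linarith
  have h4 : (1 + γ * L) * (f p + ‖x - p‖ ^ 2 / (2 * γ) - m) =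
      f p - m + γ * L * (f p - m) + γ⁻¹ * ‖x - p‖ ^ 2 - ‖x - p‖ ^ 2 / (2 * γ)
        + L / 2 * ‖x - p‖ ^ 2 := by
    field_simp
    ring
  linarith

theorem norm_sub_prox_sq_mul_le_moreau {f : E → ℝ} {f' : E → E} {L γ m : ℝ} (hLpos : 0 < L)
    (hγ : 0 < γ)
    (hf : ∀ x, HasGradientAt f (f' x) x) (hL : ∀ x y, ‖f' x - f' y‖ ≤ L * ‖x - y‖)
    (hm : ∀ x, m ≤ f x) {x p : E} (hp : f' p = γ⁻¹ • (x - p)) :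
    (1 + γ * L) * ‖x - p‖ ^ 2 ≤
      2 * L * γ ^ 2 * (f p + ‖p - x‖ ^ 2 / (2 * γ) - m) := by
  have h1 := norm_sub_prox_sq_le hLpos hγ hf hL hm hp
  rw [norm_sub_rev p x]
  have h4 : 2 * L * γ ^ 2 * (f p + ‖x - p‖ ^ 2 / (2 * γ) - m) =
      2 * L * γ ^ 2 * (f p - m) + γ * L * ‖x - p‖ ^ 2 := by
    field_simp
    ring
  linarith

theorem moreau_sub_le_inner {f : E → ℝ} (hconv : ConvexOn ℝ Set.univ f) {γ : ℝ} (hγ : 0 < γ)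
    {x p x₀ : E} (hp : HasGradientAt f (γ⁻¹ • (x - p)) p) :
    f p + ‖p - x‖ ^ 2 / (2 * γ) - f x₀ ≤ γ⁻¹ * ⟪x - p, x - x₀⟫_ℝ := by
  have h := hconv.add_inner_gradient_le hp x₀
  have h2 : ⟪x - p, x₀ - p⟫_ℝ = ‖x - p‖ ^ 2 - ⟪x - p, x - x₀⟫_ℝ := by
    rw [← real_inner_self_eq_norm_sq, ← inner_sub_right]
    congr 1
    abel
  rw [real_inner_smul_left, h2] at h
  rw [norm_sub_rev p x]
  have h3 : γ⁻¹ * ‖x - p‖ ^ 2 - ‖x - p‖ ^ 2 / (2 * γ) = ‖x - p‖ ^ 2 / (2 * γ) := by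
    field_simp
    ring
  have h4 : 0 ≤ ‖x - p‖ ^ 2 / (2 * γ) := by positivity
  linarith

end GradientInequalities

theorem le_pow_mul_of_nonneg_of_le_mul {u : ℕ → ℝ} {r : ℝ} (hu : ∀ k, 0 ≤ u k)
    (h : ∀ k, u (k + 1) ≤ r * u k) (K : ℕ) : u K ≤ r ^ K * u 0 := by
  by_cases h0 : ∀ k, u k = 0
  · simp [h0]
  · push Not at h0
    obtain ⟨k, hk⟩ := h0
    have hpos : 0 < u k := (hu k).lt_of_ne' hk
    have hr : 0 ≤ r := nonneg_of_mul_nonneg_left ((hu _).trans (h k)) hpos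
    induction K with
    | zero => simp
    | succ K ih =>
      calc u (K + 1) ≤ r * u K := h K
        _ ≤ r * (r ^ K * u 0) := by gcongr
        _ = r ^ (K + 1) * u 0 := by ring

theorem fedexprox_rel_comp_E
    {d n : ℕ} (hn : 1 ≤ n)
    (f : Fin n → EuclideanSpace ℝ (Fin d) → ℝ)
    (f' : Fin n → EuclideanSpace ℝ (Fin d) → EuclideanSpace ℝ (Fin d))
    (L : Fin n → ℝ) (hLpos : ∀ i, 0 < L i)
    (hdiff : ∀ i x, HasGradientAt (f i) (f' i x) x)
    (hconv : ∀ i, ConvexOn ℝ Set.univ (f i))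
    (hsmooth : ∀ i x y, ‖f' i x - f' i y‖ ≤ L i * ‖x - y‖)
    (Lmax : ℝ) (hLmax : IsGreatest (Set.range L) Lmax)
    (xstar : EuclideanSpace ℝ (Fin d)) (hinterp : ∀ i, f' i xstar = 0)
    (μ : ℝ) (hμ : 0 < μ)
    (hsc : StrongConvexOn Set.univ μ (fun x => (1 / (n : ℝ)) * ∑ i, f i x))
    (γ : ℝ) (hγ : 0 < γ)
    (prox : Fin n → EuclideanSpace ℝ (Fin d) → EuclideanSpace ℝ (Fin d))
    (hprox : ∀ i x, IsMinOn (fun z => f i z + ‖z - x‖ ^ 2 / (2 * γ)) Set.univ (prox i x))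
    (hproxu : ∀ i x q, IsMinOn (fun z => f i z + ‖z - x‖ ^ 2 / (2 * γ)) Set.univ q → q = prox i x)
    (M : EuclideanSpace ℝ (Fin d) → ℝ)
    (hM : ∀ x, M x = (1 / (n : ℝ)) * ∑ i, (f i (prox i x) + ‖prox i x - x‖ ^ 2 / (2 * γ)))
    (M' : EuclideanSpace ℝ (Fin d) → EuclideanSpace ℝ (Fin d))
    (hM' : ∀ x, M' x = (1 / ((n : ℝ) * γ)) • ∑ i, (x - prox i x))
    (hMdiff : ∀ x, HasGradientAt M (M' x) x)
    (Minf : ℝ) (hMinf : Minf = M xstar) (hMinfLB : ∀ x, Minf ≤ M x)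
    (Lγ : ℝ) (hLγ : 0 < Lγ)
    (hMLip : ∀ x y, ‖M' x - M' y‖ ≤ Lγ * ‖x - y‖)
    (α : ℝ)
    (xseq : ℕ → EuclideanSpace ℝ (Fin d))
    (xtil : Fin n → ℕ → EuclideanSpace ℝ (Fin d))
    (hrec : ∀ k : ℕ, xseq (k + 1) = xseq k + α • ((1 / (n : ℝ)) • (∑ i, xtil i k) - xseq k))
    (ε₂ : ℝ) (hε₂ : 0 ≤ ε₂)
    (happrox : ∀ (i : Fin n) (k : ℕ),
      ‖xtil i k - prox i (xseq k)‖ ^ 2 ≤ ε₂ * ‖xseq k - prox i (xseq k)‖ ^ 2)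
    (hε₂lt : ε₂ < μ / (4 * Lmax))
    (hα : 0 < α) (hαle : α ≤ 1 / (γ * Lγ))
    : ∀ K : ℕ,
      γ * M (xseq K) - γ * Minf ≤
        (1 - (1 - 4 * ε₂ * Lmax / μ) * (γ * μ / (4 * (1 + γ * Lmax))) * α) ^ K *
          (γ * M (xseq 0) - γ * Minf) := by
  have hn' : (0 : ℝ) < n := by exact_mod_cast hn
  have hmin : ∀ i x, f i xstar ≤ f i x := fun i x => by
    simpa [hinterp i] using (hconv i).add_inner_gradient_le (hdiff i xstar) x
  have hsmooth' : ∀ i x y, ‖f' i x - f' i y‖ ≤ Lmax * ‖x - y‖ := fun i x y =>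
    (hsmooth i x y).trans (mul_le_mul_of_nonneg_right (hLmax.2 ⟨i, rfl⟩) (norm_nonneg _))
  have hLmaxpos : 0 < Lmax := by
    obtain ⟨i, hi⟩ := hLmax.1
    exact hi ▸ hLpos i
  have hopt : ∀ i x, f' i (prox i x) = γ⁻¹ • (x - prox i x) := fun i x =>
    gradient_eq_of_isMinOn_prox (hdiff i _) (hprox i x)
  have hMinf' : Minf = (1 / (n : ℝ)) * ∑ i, f i xstar := by
    rw [hMinf, hM]
    congr 1
    refine Finset.sum_congr rfl fun i _ => ?_
    have h : xstar = prox i xstar := hproxu i xstar xstar (isMinOn_iff.2 fun z _ => by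
      have := hmin i z
      have : 0 ≤ ‖z - xstar‖ ^ 2 / (2 * γ) := by positivity
      simp
      linarith)
    rw [← h]
    simp
  have hgap : ∀ x, M x - Minf = (1 / (n : ℝ)) *
      ∑ i, (f i (prox i x) + ‖prox i x - x‖ ^ 2 / (2 * γ) - f i xstar) := fun x => by
    rw [hM, hMinf', Finset.sum_sub_distrib, mul_sub]
  set c := 1 + γ * Lmax with hc
  have hcpos : 0 < c := by positivity
  have hgrowth : ∀ x, μ / 2 * ‖x - xstar‖ ^ 2 ≤ c * (M x - Minf) := fun x => by
    have h1 := hsc.add_sq_le_of_le (x₀ := xstar) (fun x => by gcongr with i; exact hmin i x) x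
    have h2 : (1 / (n : ℝ)) * ∑ i, (f i x - f i xstar) ≤ c * (M x - Minf) := by
      rw [hgap, mul_left_comm, Finset.mul_sum _ _ c]
      gcongr with i
      exact le_mul_moreau hLmaxpos hγ (hdiff i) (hsmooth' i) (hmin i) (hopt i x)
    rw [Finset.sum_sub_distrib, mul_sub] at h2
    linarith
  have hdist : ∀ x, c * ((1 / (n : ℝ)) * ∑ i, ‖x - prox i x‖ ^ 2) ≤
      2 * Lmax * γ ^ 2 * (M x - Minf) := fun x => by
    rw [hgap, mul_left_comm, mul_left_comm _ (1 / (n : ℝ)), Finset.mul_sum _ _ c,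
      Finset.mul_sum _ _ (2 * Lmax * γ ^ 2)]
    refine mul_le_mul_of_nonneg_left (Finset.sum_le_sum fun i _ => ?_) (by positivity)
    exact norm_sub_prox_sq_mul_le_moreau hLmaxpos hγ (hdiff i) (hsmooth' i) (hmin i) (hopt i x)
  have hnonneg : ∀ x, 0 ≤ M x - Minf := fun x => sub_nonneg.2 (hMinfLB x)
  have hinner : ∀ x, M x - Minf ≤ ‖M' x‖ * ‖x - xstar‖ := fun x => by
    refine le_trans ?_ (real_inner_le_norm _ _)
    rw [hgap, hM', real_inner_smul_left, sum_inner, one_div_mul_eq_div, ← one_div_mul_one_div,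
      mul_assoc, Finset.mul_sum, ← one_div_mul_eq_div]
    gcongr with i
    rw [one_div]
    exact moreau_sub_le_inner (hconv i) hγ (hopt i x ▸ hdiff i (prox i x))
  have hPL : ∀ x, μ * (M x - Minf) ≤ 2 * c * ‖M' x‖ ^ 2 := fun x => by
    rcases (hnonneg x).eq_or_lt with h0 | h0
    · rw [← h0, mul_zero]
      positivity
    · refine le_of_mul_le_mul_right ?_ h0
      calc μ * (M x - Minf) * (M x - Minf) = μ * (M x - Minf) ^ 2 := by ring
        _ ≤ μ * (‖M' x‖ * ‖x - xstar‖) ^ 2 := by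
          have := hinner x
          gcongr
        _ = 2 * ‖M' x‖ ^ 2 * (μ / 2 * ‖x - xstar‖ ^ 2) := by ring
        _ ≤ 2 * ‖M' x‖ ^ 2 * (c * (M x - Minf)) := by
          have := hgrowth x
          gcongr
        _ = 2 * c * ‖M' x‖ ^ 2 * (M x - Minf) := by ring
  set e : ℕ → EuclideanSpace ℝ (Fin d) := fun k =>
    γ⁻¹ • ((1 / (n : ℝ)) • ∑ i, (xtil i k - prox i (xseq k))) with he
  have herr : ∀ k, c * ‖e k‖ ^ 2 ≤ 2 * ε₂ * Lmax * (M (xseq k) - Minf) := fun k => by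
    have h1 : ‖(1 / (n : ℝ)) • ∑ i, (xtil i k - prox i (xseq k))‖ ^ 2 ≤
        ε₂ * ((1 / (n : ℝ)) * ∑ i, ‖xseq k - prox i (xseq k)‖ ^ 2) := by
      refine (norm_average_sq_le hn _).trans ?_
      rw [mul_left_comm, Finset.mul_sum _ _ ε₂]
      gcongr with i
      exact happrox i k
    have h2 := mul_le_mul_of_nonneg_left (hdist (xseq k)) hε₂
    have h3 := mul_le_mul_of_nonneg_left h1 hcpos.le
    rw [he]
    simp only
    rw [norm_smul, Real.norm_of_nonneg (inv_nonneg.2 hγ.le), mul_pow, inv_pow, mul_left_comm,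
      inv_mul_le_iff₀ (by positivity)]
    linarith
  have hstep : ∀ k, xseq (k + 1) = xseq k - (α * γ) • (M' (xseq k) - e k) := fun k => by
    have h1 : γ • M' (xseq k) = xseq k - (1 / (n : ℝ)) • ∑ i, prox i (xseq k) := by
      rw [hM', smul_smul, Finset.sum_sub_distrib, smul_sub]
      have hγn : γ * (1 / (n * γ)) = 1 / n := by field_simp
      rw [hγn]
      congr 1
      rw [Finset.sum_const, Finset.card_univ, Fintype.card_fin, ← Nat.cast_smul_eq_nsmul ℝ,
        smul_smul, one_div_mul_cancel hn'.ne', one_smul]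
    have h2 : γ • e k = (1 / (n : ℝ)) • ∑ i, xtil i k -
        (1 / (n : ℝ)) • ∑ i, prox i (xseq k) := by
      rw [he]
      simp only
      rw [smul_inv_smul₀ hγ.ne', Finset.sum_sub_distrib, smul_sub]
    rw [hrec, mul_smul, smul_sub γ, h1, h2, sub_sub_sub_cancel_right, sub_eq_add_neg (xseq k),
      ← smul_neg, neg_sub]
  have hdescent : ∀ k, M (xseq (k + 1)) - Minf ≤
      (1 - (1 - 4 * ε₂ * Lmax / μ) * (γ * μ / (4 * c)) * α) * (M (xseq k) - Minf) := fun k => by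
    have hαL : α * γ * Lγ ≤ 1 := by
      rw [le_div_iff₀ (by positivity)] at hαle
      linarith
    have h := perturbed_gradient_step_le hMdiff hMLip (by positivity) hαL (xseq k) (e k)
    rw [← hstep] at h
    have h1 : μ * (M (xseq k) - Minf) / (2 * c) ≤ ‖M' (xseq k)‖ ^ 2 := by
      rw [div_le_iff₀ (by positivity)]
      linarith [hPL (xseq k)]
    have h2 : ‖e k‖ ^ 2 ≤ 2 * ε₂ * Lmax * (M (xseq k) - Minf) / c := by
      rw [le_div_iff₀ hcpos]
      linarith [herr k]
    have h3 := mul_le_mul_of_nonneg_left h1 (show 0 ≤ α * γ / 2 by positivity)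
    have h4 := mul_le_mul_of_nonneg_left h2 (show 0 ≤ α * γ / 2 by positivity)
    have h5 : (1 - (1 - 4 * ε₂ * Lmax / μ) * (γ * μ / (4 * c)) * α) * (M (xseq k) - Minf) =
        M (xseq k) - Minf - α * γ / 2 * (μ * (M (xseq k) - Minf) / (2 * c)) +
          α * γ / 2 * (2 * ε₂ * Lmax * (M (xseq k) - Minf) / c) := by
      field_simp
      ring
    linarith
  intro K
  have h := le_pow_mul_of_nonneg_of_le_mul (fun k => hnonneg (xseq k)) hdescent K
  calc γ * M (xseq K) - γ * Minf = γ * (M (xseq K) - Minf) := by ring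
    _ ≤ γ * ((1 - (1 - 4 * ε₂ * Lmax / μ) * (γ * μ / (4 * c)) * α) ^ K *
        (M (xseq 0) - Minf)) := by gcongr
    _ = _ := by ring
end

section
/- Let f : ℝ^d → ℝ be differentiable, convex and L-smooth (∇f is L-Lipschitz, L > 0), fix γ > 0 and x ∈ ℝ^d, and let p = prox_{γf}(x) be the unique minimizer of A(z) = f(z) + ‖z − x‖²/(2γ). Let (z_t) be the gradient-descent iterates on A started from z₀ = x with step size η = γ/(1 + γL), i.e., z_{t+1} = z_t − η∇A(z_t). Then for every ε₂ ∈ (0, 1) and every natural number t with t ≥ (1 + γL) · log(1/ε₂), one has ‖z_t − p‖² ≤ ε₂ · ‖x − p‖². -/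
section

variable {E : Type*} [NormedAddCommGroup E] [InnerProductSpace ℝ E] [CompleteSpace E]
  {f : E → ℝ} {f' : E → E}

theorem HasGradientAt.hasDerivAt_comp_add_smul {g u v : E} {s : ℝ}
    (h : HasGradientAt f g (u + s • v)) :
    HasDerivAt (fun r : ℝ => f (u + r • v)) (inner ℝ g v) s := by
  have hline : HasDerivAt (fun r : ℝ => u + r • v) v s := by
    simpa using ((hasDerivAt_id s).smul_const v).const_add u
  exact (h.hasFDerivAt.comp_hasDerivAt s hline).congr_deriv (by simp)

/-- A convex function lies above its tangent hyperplanes. -/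
theorem ConvexOn.add_inner_le_of_hasGradientAt_s9 (hconv : ConvexOn ℝ Set.univ f) {g u : E}
    (h : HasGradientAt f g u) (v : E) : f u + inner ℝ g v ≤ f (u + v) := by
  have hline : ConvexOn ℝ Set.univ (fun r : ℝ => f (u + r • v)) := by
    have := hconv.comp_affineMap (AffineMap.lineMap u (u + v))
    simpa [Function.comp_def, AffineMap.lineMap_apply, add_comm] using this
  have hderiv : HasDerivAt (fun r : ℝ => f (u + r • v)) (inner ℝ g v) 0 :=
    HasGradientAt.hasDerivAt_comp_add_smul (by simpa using h)
  have := hline.le_slope_of_hasDerivAt (Set.mem_univ 0) (Set.mem_univ 1) one_pos hderiv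
  simp only [slope_def_field, one_smul, zero_smul, add_zero, sub_zero, div_one] at this
  linarith

/-- The descent lemma: the quadratic upper bound for a function with Lipschitz gradient. -/
theorem le_add_inner_add_of_lipschitz_gradient {L : ℝ} (hdiff : ∀ x, HasGradientAt f (f' x) x)
    (hsmooth : ∀ u v, ‖f' u - f' v‖ ≤ L * ‖u - v‖) (u v : E) :
    f (u + v) ≤ f u + inner ℝ (f' u) v + L / 2 * ‖v‖ ^ 2 := by
  have hderiv (s : ℝ) : HasDerivAt (fun r : ℝ => f (u + r • v)) (inner ℝ (f' (u + s • v)) v) s :=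
    (hdiff _).hasDerivAt_comp_add_smul
  have hbound (s : ℝ) :
      HasDerivAt (fun r : ℝ => f u + r * inner ℝ (f' u) v + L / 2 * ‖v‖ ^ 2 * r ^ 2)
        (inner ℝ (f' u) v + L * ‖v‖ ^ 2 * s) s := by
    refine ((((hasDerivAt_id s).mul_const _).const_add _).add
      (((hasDerivAt_id s).pow 2).const_mul _)).congr_deriv ?_
    simp
    ring
  have hle : ∀ s ∈ Set.Ico (0 : ℝ) 1,
      inner ℝ (f' (u + s • v)) v ≤ inner ℝ (f' u) v + L * ‖v‖ ^ 2 * s := by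
    intro s hs
    have hcs := real_inner_le_norm (f' (u + s • v) - f' u) v
    have hlip := hsmooth (u + s • v) u
    rw [add_sub_cancel_left, norm_smul, Real.norm_of_nonneg hs.1] at hlip
    rw [inner_sub_left] at hcs
    nlinarith [mul_le_mul_of_nonneg_right hlip (norm_nonneg v)]
  have := image_le_of_deriv_right_le_deriv_boundary
    (fun s _ => (hderiv s).continuousAt.continuousWithinAt)
    (fun s _ => (hderiv s).hasDerivWithinAt) (by simp)
    (fun s _ => (hbound s).continuousAt.continuousWithinAt)
    (fun s _ => (hbound s).hasDerivWithinAt) hle (Set.right_mem_Icc.2 zero_le_one)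
  simpa using this

/-- One gradient step on the proximal objective contracts the squared distance to its minimizer. -/
theorem norm_gradient_step_sub_prox_sq_le {L γ : ℝ} (hL : 0 ≤ L) (hγ : 0 < γ)
    (hdiff : ∀ x, HasGradientAt f (f' x) x) (hconv : ConvexOn ℝ Set.univ f)
    (hsmooth : ∀ u v, ‖f' u - f' v‖ ≤ L * ‖u - v‖) {x p : E}
    (hp : IsMinOn (fun z => f z + ‖z - x‖ ^ 2 / (2 * γ)) Set.univ p) (z : E) :
    ‖z - (γ / (1 + γ * L)) • (f' z + (1 / γ) • (z - x)) - p‖ ^ 2 ≤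
      (1 - 1 / (1 + γ * L)) * ‖z - p‖ ^ 2 := by
  have hκ : 0 < 1 + γ * L := by positivity
  obtain ⟨η, hη⟩ : ∃ η, η = γ / (1 + γ * L) := ⟨_, rfl⟩
  have hη_pos : 0 < η := hη ▸ by positivity
  have hη_div : 1 / (1 + γ * L) = η / γ := by rw [hη]; field_simp
  have hη_mul : η * (1 + γ * L) = γ := by rw [hη]; field_simp
  obtain ⟨G, hG⟩ : ∃ G, G = f' z + (1 / γ) • (z - x) := ⟨_, rfl⟩
  have hf' : f' z = G - (1 / γ) • (z - x) := by rw [hG]; abel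
  rw [← hη, ← hG, hη_div]
  have htangent := hconv.add_inner_le_of_hasGradientAt_s9 (hdiff z) (-(z - p))
  have hdescent := le_add_inner_add_of_lipschitz_gradient hdiff hsmooth z (-(η • G))
  have hmin := hp (Set.mem_univ (z + -(η • G)))
  simp only [Set.mem_ofPred_eq] at hmin
  rw [show z + -(z - p) = p by abel] at htangent
  rw [show p - x = (z - x) - (z - p) by abel,
    show z + -(η • G) - x = (z - x) - η • G by abel] at hmin
  rw [show z - η • G - p = (z - p) - η • G by abel]
  rw [hf'] at htangent hdescent
  generalize z - x = b at htangent hdescent hmin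
  generalize z - p = e at htangent hmin ⊢
  simp only [norm_sub_sq_real, norm_neg, norm_smul, mul_pow, inner_neg_right, inner_sub_left,
    real_inner_smul_left, real_inner_smul_right, Real.norm_eq_abs, sq_abs] at htangent hdescent hmin ⊢
  rw [real_inner_self_eq_norm_sq] at hdescent
  have hcomm : inner ℝ G e = inner ℝ e G := real_inner_comm _ _
  rw [hcomm] at htangent
  have hkey : ‖e‖ ^ 2 / (2 * γ) - inner ℝ e G + η / 2 * ‖G‖ ^ 2 ≤ 0 := by
    have hstep : L / 2 * η ^ 2 + η ^ 2 / (2 * γ) = η / 2 := by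
      field_simp
      linear_combination hη_mul
    have hsum := add_le_add (add_le_add htangent hdescent) hmin
    linear_combination hsum + ‖G‖ ^ 2 * hstep
  linear_combination 2 * η * hkey

end


theorem local_gd_rel
    {d : ℕ}
    (f : EuclideanSpace ℝ (Fin d) → ℝ)
    (f' : EuclideanSpace ℝ (Fin d) → EuclideanSpace ℝ (Fin d))
    (L : ℝ) (hL : 0 < L)
    (hdiff : ∀ x, HasGradientAt f (f' x) x)
    (hconv : ConvexOn ℝ Set.univ f)
    (hsmooth : ∀ u v, ‖f' u - f' v‖ ≤ L * ‖u - v‖)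
    (γ : ℝ) (hγ : 0 < γ)
    (x p : EuclideanSpace ℝ (Fin d))
    (hp : IsMinOn (fun z => f z + ‖z - x‖ ^ 2 / (2 * γ)) Set.univ p)
    (hpu : ∀ q, IsMinOn (fun z => f z + ‖z - x‖ ^ 2 / (2 * γ)) Set.univ q → q = p)
    (A' : EuclideanSpace ℝ (Fin d) → EuclideanSpace ℝ (Fin d))
    (hA' : ∀ z, A' z = f' z + (1 / γ) • (z - x))
    (z : ℕ → EuclideanSpace ℝ (Fin d))
    (hz0 : z 0 = x)
    (hzrec : ∀ t : ℕ, z (t + 1) = z t - (γ / (1 + γ * L)) • A' (z t))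
    : ∀ ε₂ : ℝ, 0 < ε₂ → ε₂ < 1 → ∀ t : ℕ,
      (1 + γ * L) * Real.log (1 / ε₂) ≤ (t : ℝ) → ‖z t - p‖ ^ 2 ≤ ε₂ * ‖x - p‖ ^ 2 := by
  intro ε₂ hε _ t ht
  have hκ : 0 < 1 + γ * L := by positivity
  have hrate : 0 ≤ 1 - 1 / (1 + γ * L) := by
    rw [sub_nonneg, div_le_one hκ]
    nlinarith [mul_pos hγ hL]
  have hpow (n : ℕ) : ‖z n - p‖ ^ 2 ≤ (1 - 1 / (1 + γ * L)) ^ n * ‖x - p‖ ^ 2 := by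
    induction n with
    | zero => simp [hz0]
    | succ n ih =>
      rw [hzrec, hA', pow_succ' (1 - 1 / (1 + γ * L)), mul_assoc]
      exact (norm_gradient_step_sub_prox_sq_le hL.le hγ hdiff hconv hsmooth hp (z n)).trans
        (mul_le_mul_of_nonneg_left ih hrate)
  refine (hpow t).trans (mul_le_mul_of_nonneg_right ?_ (sq_nonneg _))
  calc (1 - 1 / (1 + γ * L)) ^ t
      ≤ Real.exp (-(1 / (1 + γ * L))) ^ t :=
        pow_le_pow_left₀ hrate (Real.one_sub_le_exp_neg _) t
    _ = Real.exp (-(t / (1 + γ * L))) := by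
        rw [← Real.exp_nat_mul]
        ring_nf
    _ ≤ Real.exp (Real.log ε₂) := by
        rw [one_div, Real.log_inv] at ht
        rw [Real.exp_le_exp, neg_le, le_div_iff₀ hκ, mul_comm]
        exact ht
    _ = ε₂ := Real.exp_log hε
end
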